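/- Let p ≥ 1 and define the nodal Discontinuous Galerkin left correction function h_L = ((−1)^p / 2)(P_p − P_{p+1}). Then h_L(−1) = 1, h_L(1) = 0, and h_L satisfies the GLSFR condition of order p. -/

import Mathlib

open Polynomial

/-- The degree-`n` Legendre polynomial of the first kind on `[-1,1]`, defined by the
Rodrigues formula `P_n(x) = 1/(2^n n!) · dⁿ/dxⁿ (x² − 1)ⁿ`. -/
noncomputable def legendre (n : ℕ) : Polynomial ℝ :=
  Polynomial.C ((1 : ℝ) / (2 ^ n * n.factorial)) *
    (Polynomial.derivative^[n] ((Polynomial.X ^ 2 - 1) ^ n))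

/-- A real polynomial `h` satisfies the GLSFR condition of order `p` if
`∫_{-1}^{1} h(ξ) u'(ξ) dξ = 0` for every real polynomial `u` of degree at most `p`. -/
def GLSFRCondition (p : ℕ) (h : Polynomial ℝ) : Prop :=
  ∀ u : Polynomial ℝ, u.natDegree ≤ p →
    (∫ ξ in (-1:ℝ)..1, h.eval ξ * ((Polynomial.derivative u).eval ξ)) = 0

theorem eval_iterate_derivative_X_sub_C_pow_mul (n : ℕ) (t : ℝ) (q : ℝ[X]) :
    (derivative^[n] ((X - C t) ^ n * q)).eval t = n.factorial * q.eval t := by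
  rw [← factorial_smul_hasseDeriv, LinearMap.smul_apply, eval_smul, ← taylor_coeff]
  have h : taylor t ((X - C t) ^ n * q) = X ^ n * taylor t q := by
    simp [taylor_apply]
  rw [h, nsmul_eq_mul]
  simpa using Or.inl (coeff_X_pow_mul (taylor t q) n 0)

theorem X_sq_sub_one_pow_eq (n : ℕ) :
    ((X ^ 2 - 1) ^ n : ℝ[X]) = (X - C 1) ^ n * (X - C (-1)) ^ n := by
  rw [← mul_pow]
  congr 1
  simp only [map_neg, map_one]
  ring

theorem legendre_eval_one (n : ℕ) : (legendre n).eval 1 = 1 := by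
  rw [legendre, X_sq_sub_one_pow_eq, eval_mul, eval_iterate_derivative_X_sub_C_pow_mul]
  have := n.factorial_ne_zero
  simp only [eval_C, eval_pow, eval_sub, eval_X]
  norm_num
  field_simp

theorem legendre_eval_neg_one (n : ℕ) : (legendre n).eval (-1) = (-1) ^ n := by
  rw [legendre, X_sq_sub_one_pow_eq, mul_comm ((X - C 1) ^ n), eval_mul,
    eval_iterate_derivative_X_sub_C_pow_mul]
  have := n.factorial_ne_zero
  have h : ((-1 : ℝ) - 1) ^ n = (-1) ^ n * 2 ^ n := by
    rw [← mul_pow]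
    norm_num
  simp only [eval_C, eval_pow, eval_sub, eval_X, h]
  field_simp

theorem eval_iterate_derivative_eq_zero_of_pow_dvd {n k : ℕ} (hk : k < n) {t : ℝ} {f : ℝ[X]}
    (h : (X - C t) ^ n ∣ f) : (derivative^[k] f).eval t = 0 :=
  dvd_iff_isRoot.mp <| (dvd_pow_self _ (Nat.sub_ne_zero_of_lt hk)).trans
    (pow_sub_dvd_iterate_derivative_of_pow_dvd k h)

theorem intervalIntegrable_eval_mul_eval (f g : ℝ[X]) (a b : ℝ) :
    IntervalIntegrable (fun x => f.eval x * g.eval x) MeasureTheory.volume a b :=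
  (f.continuous.mul g.continuous).intervalIntegrable a b

theorem integral_iterate_derivative_mul_eq_zero {n k : ℕ} (hk : k ≤ n) {a b : ℝ} {f v : ℝ[X]}
    (ha : (X - C a) ^ n ∣ f) (hb : (X - C b) ^ n ∣ f) (hv : derivative^[k] v = 0) :
    ∫ x in a..b, (derivative^[k] f).eval x * v.eval x = 0 := by
  induction k generalizing v with
  | zero => simp_all
  | succ k ih =>
    have parts := intervalIntegral.integral_deriv_mul_eq_sub (a := a) (b := b)
      (fun x _ => (derivative^[k] f).hasDerivAt x) (fun x _ => v.hasDerivAt x)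
      (Polynomial.continuous _).continuousOn.intervalIntegrable
      (Polynomial.continuous _).continuousOn.intervalIntegrable
    rw [intervalIntegral.integral_add
      (intervalIntegrable_eval_mul_eval _ _ _ _)
      (intervalIntegrable_eval_mul_eval _ _ _ _),
      ih (by lia) hv, eval_iterate_derivative_eq_zero_of_pow_dvd hk ha,
      eval_iterate_derivative_eq_zero_of_pow_dvd hk hb] at parts
    rw [Function.iterate_succ_apply']
    simpa using parts

theorem integral_legendre_mul_eq_zero {n : ℕ} {v : ℝ[X]} (hv : derivative^[n] v = 0) :
    ∫ x in (-1 : ℝ)..1, (legendre n).eval x * v.eval x = 0 := by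
  simp only [legendre, eval_mul, eval_C, mul_assoc, intervalIntegral.integral_const_mul]
  rw [integral_iterate_derivative_mul_eq_zero le_rfl _ _ hv, mul_zero]
  · exact X_sq_sub_one_pow_eq n ▸ dvd_mul_left _ _
  · exact X_sq_sub_one_pow_eq n ▸ dvd_mul_right _ _

theorem nodal_dg_correction_is_glsfr (p : ℕ) (hp : 1 ≤ p) (hL : Polynomial ℝ)
    (hdef : hL = Polynomial.C ((-1 : ℝ) ^ p / 2) * (legendre p - legendre (p + 1))) :
    hL.eval (-1 : ℝ) = 1 ∧ hL.eval (1 : ℝ) = 0 ∧ GLSFRCondition p hL := by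
  subst hdef
  refine ⟨?_, ?_, fun u hu => ?_⟩
  · have h : (-1 : ℝ) ^ p * (-1) ^ p = 1 := by
      rw [← mul_pow]
      norm_num
    simp only [eval_mul, eval_C, eval_sub, legendre_eval_neg_one, pow_succ]
    linear_combination h
  · simp [legendre_eval_one]
  · have hv : derivative^[p] (derivative u) = 0 :=
      iterate_derivative_eq_zero (x := p + 1) (Nat.lt_succ_of_le hu)
    have hv' : derivative^[p + 1] (derivative u) = 0 := by
      rw [Function.iterate_succ_apply', hv, derivative_zero]
    simp only [eval_mul, eval_C, eval_sub, mul_assoc, sub_mul,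
      intervalIntegral.integral_const_mul]
    rw [intervalIntegral.integral_sub
      (intervalIntegrable_eval_mul_eval _ _ _ _)
      (intervalIntegrable_eval_mul_eval _ _ _ _),
      integral_legendre_mul_eq_zero hv, integral_legendre_mul_eq_zero hv', sub_zero, mul_zero]
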